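/- Let B be a cocommutative Hopf algebra with antipode J_B and C a Hopf algebra with antipode J_C which is a B-bimodule bialgebra. Then the L-R smash product C ♮ B, endowed with the tensor product coalgebra structure, is a Hopf algebra with antipode J_⋆(f⊗a) = Σ_{(a)} J_B(a₍₁₎) ⇀ J_C(f) ↼ J_B(a₍₂₎) ⊗ J_B(a₍₃₎). -/

import Mathlib

open TensorProduct

/-- `sweedMul m F G (Σ a₁ ⊗ a₂) = Σ m (F a₁) (G a₂)`: the Sweedler-style
combination used to express module-algebra conditions. -/
noncomputable def sweedMul {k C B : Type*} [Field k] [AddCommGroup C] [Module k C]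
    [AddCommGroup B] [Module k B]
    (m : C →ₗ[k] C →ₗ[k] C) (F G : B →ₗ[k] C) : B ⊗[k] B →ₗ[k] C :=
  (TensorProduct.lift m).comp (TensorProduct.map F G)

/-- The L-R smash product multiplication on `C ⊗ B`:
`(f ⊗ a) ⋆ (g ⊗ b) = Σ (f ↼ b₁)·(a₁ ⇀ g) ⊗ a₂ b₂`, where `l a g = a ⇀ g`
and `r b f = f ↼ b`, and `m` is the multiplication of `C`. -/
noncomputable def lrMul (k C B : Type*) [Field k] [AddCommGroup C] [Module k C]
    [Ring B] [Bialgebra k B]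
    (m : C →ₗ[k] C →ₗ[k] C) (l r : B →ₗ[k] C →ₗ[k] C) :
    (C ⊗[k] B) ⊗[k] (C ⊗[k] B) →ₗ[k] C ⊗[k] B :=
  (TensorProduct.map
    ((TensorProduct.lift m) ∘ₗ
      (TensorProduct.map (TensorProduct.lift r.flip) (TensorProduct.lift l.flip)) ∘ₗ
      (tensorTensorTensorComm k C C B B).toLinearMap ∘ₗ
      (TensorProduct.map LinearMap.id (TensorProduct.comm k B B).toLinearMap))
    LinearMap.id) ∘ₗ
  ((TensorProduct.assoc k (C ⊗[k] C) (B ⊗[k] B) B).symm.toLinearMap) ∘ₗ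
  (TensorProduct.map LinearMap.id (TensorProduct.map LinearMap.id (LinearMap.mul' k B))) ∘ₗ
  (TensorProduct.map LinearMap.id (tensorTensorTensorComm k B B B B).toLinearMap) ∘ₗ
  (tensorTensorTensorComm k C (B ⊗[k] B) C (B ⊗[k] B)).toLinearMap ∘ₗ
  (TensorProduct.map
    (TensorProduct.map LinearMap.id (Coalgebra.comul (R := k)))
    (TensorProduct.map LinearMap.id (Coalgebra.comul (R := k))))

/-- The tensor-product coproduct on `C ⊗ B`:
`Δ(f ⊗ a) = Σ (f₁ ⊗ a₁) ⊗ (f₂ ⊗ a₂)`. -/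
noncomputable def tensorComul (k C B : Type*) [Field k]
    [Ring C] [Bialgebra k C] [Ring B] [Bialgebra k B] :
    C ⊗[k] B →ₗ[k] (C ⊗[k] B) ⊗[k] (C ⊗[k] B) :=
  (tensorTensorTensorComm k C C B B).toLinearMap ∘ₗ
    (TensorProduct.map (Coalgebra.comul (R := k)) (Coalgebra.comul (R := k)))

/-- The tensor-product counit on `C ⊗ B`: `ε(f ⊗ a) = ε(f) ε(a)`. -/
noncomputable def tensorCounit (k C B : Type*) [Field k]
    [Ring C] [Bialgebra k C] [Ring B] [Bialgebra k B] :
    C ⊗[k] B →ₗ[k] k :=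
  (TensorProduct.lid k k).toLinearMap ∘ₗ
    (TensorProduct.map (Coalgebra.counit (R := k)) (Coalgebra.counit (R := k)))

/-- The antipode of the L-R smash product:
`J⋆(f ⊗ a) = Σ J_B(a₁) ⇀ J_C(f) ↼ J_B(a₂) ⊗ J_B(a₃)`. -/
noncomputable def lrAntipode (k C B : Type*) [Field k]
    [Ring C] [HopfAlgebra k C] [Ring B] [HopfAlgebra k B]
    (l r : B →ₗ[k] C →ₗ[k] C) : C ⊗[k] B →ₗ[k] C ⊗[k] B :=
  (TensorProduct.map
      ((TensorProduct.lift l) ∘ₗ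
        (TensorProduct.map LinearMap.id (TensorProduct.lift r.flip)))
      LinearMap.id) ∘ₗ
  (TensorProduct.map (TensorProduct.assoc k B C B).toLinearMap LinearMap.id) ∘ₗ
  (TensorProduct.map
      (TensorProduct.map (TensorProduct.comm k C B).toLinearMap LinearMap.id)
      LinearMap.id) ∘ₗ
  (TensorProduct.map (TensorProduct.assoc k C B B).symm.toLinearMap LinearMap.id) ∘ₗ
  (TensorProduct.assoc k C (B ⊗[k] B) B).symm.toLinearMap ∘ₗ
  (TensorProduct.map LinearMap.id (TensorProduct.assoc k B B B).symm.toLinearMap) ∘ₗ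
  (TensorProduct.map (HopfAlgebra.antipode (R := k))
    (TensorProduct.map (HopfAlgebra.antipode (R := k))
      (TensorProduct.map (HopfAlgebra.antipode (R := k)) (HopfAlgebra.antipode (R := k))))) ∘ₗ
  (TensorProduct.map LinearMap.id
    (TensorProduct.map LinearMap.id (Coalgebra.comul (R := k)))) ∘ₗ
  (TensorProduct.map LinearMap.id (Coalgebra.comul (R := k)))

/-! ## Helper material

Throughout, `Δ` is the coproduct of `B` or `C`, and `J` stands for the antipodes.  The strategy is:
* rewrite each expression as a fixed linear map applied to an iterated coproduct of elements of `B`;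
* reshape those iterated coproducts by coassociativity and cocommutativity (the `tree` lemmas);
* contract adjacent factors with the antipode axiom (the `contract` lemmas);
* check the equality of the fixed linear maps by induction down to pure tensors. -/

section LRSmashHelpers

open Coalgebra HopfAlgebra

variable {k C B : Type*} [Field k] [Ring C] [HopfAlgebra k C] [Ring B] [HopfAlgebra k B]
  (l r : B →ₗ[k] C →ₗ[k] C)

/-- `Σ ε(b₁) ⊗ ε(b₂) = ε(b) ⊗ 1`. -/
theorem lrs_counit_counit (b : B) :
    map (counit (R := k) (A := B)) (counit (R := k) (A := B)) (comul b)
      = (counit (R := k) b) ⊗ₜ[k] (1 : k) := by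
    have e : map (counit (R := k) (A := B)) (counit (R := k) (A := B)) (comul b)
      = LinearMap.rTensor k (counit (R := k) (A := B))
        (LinearMap.lTensor B (counit (R := k) (A := B)) (comul b)) := by
      rw [← LinearMap.comp_apply (LinearMap.rTensor k _), LinearMap.rTensor_comp_lTensor]
    rw [e, lTensor_counit_comul, LinearMap.rTensor_tmul]

theorem lrs_tree4 [IsCocomm k B] :
    (tensorTensorTensorComm k B B B B).toLinearMap ∘ₗ
      (map (comul (R := k) (A := B)) (comul (R := k) (A := B))) ∘ₗ comul (R := k)
    = (map (comul (R := k) (A := B)) (comul (R := k) (A := B))) ∘ₗ comul (R := k) := by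
  simp [coassoc_simps]

theorem lrs_tree4b [IsCocomm k B] :
    (tensorTensorTensorComm k B B B B).toLinearMap ∘ₗ
     (TensorProduct.assoc k B B (B ⊗[k] B)).symm.toLinearMap ∘ₗ
      (map LinearMap.id (map LinearMap.id (comul (R := k) (A := B)))) ∘ₗ
      (map LinearMap.id (comul (R := k) (A := B))) ∘ₗ comul (R := k)
    = (map (comul (R := k) (A := B)) (comul (R := k) (A := B))) ∘ₗ comul (R := k) := by
  simp [coassoc_simps]

theorem lrs_tree6 :
    (TensorProduct.assoc k (B ⊗[k] B) (B ⊗[k] B) (B ⊗[k] B)).symm.toLinearMap ∘ₗ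
    (map (comul (R := k) (A := B))
      ((map (comul (R := k) (A := B)) (comul (R := k) (A := B))) ∘ₗ comul (R := k)))
      ∘ₗ comul (R := k)
    = (map
      ((map (comul (R := k) (A := B)) (comul (R := k) (A := B))) ∘ₗ comul (R := k))
       (comul (R := k) (A := B)))
      ∘ₗ comul (R := k) := by
  simp [coassoc_simps]

theorem lrs_tree6' :
    (TensorProduct.assoc k (B ⊗[k] B) (B ⊗[k] B) (B ⊗[k] B)).toLinearMap ∘ₗ
     (map
      ((map (comul (R := k) (A := B)) (comul (R := k) (A := B))) ∘ₗ comul (R := k))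
       (comul (R := k) (A := B)))
      ∘ₗ comul (R := k)
    = (map (comul (R := k) (A := B))
      ((map (comul (R := k) (A := B)) (comul (R := k) (A := B))) ∘ₗ comul (R := k)))
      ∘ₗ comul (R := k) := by
  simp [coassoc_simps]

open WithConv in
theorem lrs_comul_antipode [IsCocomm k B]
    (b : B) : comul (R := k) (antipode k b)
      = map (antipode k) (antipode k) (comul (R := k) b) := by
  have h1 := LinearMap.comul_right_inv (R := k) (C := B)
  have h2 : toConv ((map (antipode k (A := B)) (antipode k (A := B))) ∘ₗ
      comul (R := k)) * toConv (comul (R := k) (A := B)) = 1 := by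
    have h := LinearMap.convMul_comp_coalgHom_distrib
      (toConv (antipode k (A := B ⊗[k] B))) (toConv LinearMap.id) (comulCoalgHom k B)
    rw [LinearMap.antipode_mul_id] at h
    have e : (comulCoalgHom k B).toLinearMap = comul (R := k) (A := B) := rfl
    have e2 : antipode k (A := B ⊗[k] B)
      = map (antipode k (A := B)) (antipode k (A := B)) := rfl
    have e3 : (counit (R := k) (A := B ⊗[k] B)) ∘ₗ comul (R := k) (A := B) = counit (R := k) :=
      (comulCoalgHom k B).counit_comp
    rw [e, e2] at h
    apply WithConv.ofConv_injective
    refine Eq.trans h.symm ?_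
    rw [LinearMap.convOne_def, LinearMap.convOne_def, ofConv_toConv, ofConv_toConv,
      LinearMap.comp_assoc, e3]
  have := left_inv_eq_right_inv h2 h1
  exact (LinearMap.congr_fun (WithConv.toConv_injective this) b).symm

theorem lrs_comul_antipode' [IsCocomm k B]
    (b : B) : comul (R := k) (antipode k b)
      = map (antipode k) (antipode k)
        (TensorProduct.comm k B B (comul (R := k) b)) := by
  rw [lrs_comul_antipode, comm_comul]

theorem lrs_contractR :
    (map (LinearMap.mul' k B ∘ₗ map LinearMap.id (antipode k))
      (LinearMap.mul' k B ∘ₗ map LinearMap.id (antipode k))) ∘ₗ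
      (map (comul (R := k) (A := B)) (comul (R := k) (A := B))) ∘ₗ comul (R := k)
    = (LinearMap.toSpanSingleton k _ ((1 : B) ⊗ₜ[k] (1 : B))) ∘ₗ counit (R := k) := by
  have h : LinearMap.mul' k B ∘ₗ map LinearMap.id (antipode k) ∘ₗ comul (R := k)
      = (Algebra.linearMap k B) ∘ₗ counit (R := k) := mul_antipode_lTensor_comul
  rw [← LinearMap.comp_assoc, ← map_comp, LinearMap.comp_assoc, h,
    map_comp, LinearMap.comp_assoc]
  ext b
  simp [lrs_counit_counit, Algebra.algebraMap_eq_smul_one, smul_tmul']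

theorem lrs_contractL :
    (map (LinearMap.mul' k B ∘ₗ map (antipode k) LinearMap.id)
      (LinearMap.mul' k B ∘ₗ map (antipode k) LinearMap.id)) ∘ₗ
      (map (comul (R := k) (A := B)) (comul (R := k) (A := B))) ∘ₗ comul (R := k)
    = (LinearMap.toSpanSingleton k _ ((1 : B) ⊗ₜ[k] (1 : B))) ∘ₗ counit (R := k) := by
  have h : LinearMap.mul' k B ∘ₗ map (antipode k) LinearMap.id ∘ₗ comul (R := k)
      = (Algebra.linearMap k B) ∘ₗ counit (R := k) := mul_antipode_rTensor_comul
  rw [← LinearMap.comp_assoc, ← map_comp, LinearMap.comp_assoc, h,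
    map_comp, LinearMap.comp_assoc]
  ext b
  simp [lrs_counit_counit, Algebra.algebraMap_eq_smul_one, smul_tmul']

/-- The L-R product `(f ⊗ a) ⋆ (g ⊗ b)` in which `Δ a` and `Δ b` have been replaced by
arbitrary tensors, so that the latter can be treated by tensor induction. -/
noncomputable def lrsCore  :
  ((C ⊗[k] C) ⊗[k] ((B ⊗[k] B) ⊗[k] (B ⊗[k] B))) →ₗ[k] C ⊗[k] B :=
  (map
    ((lift (LinearMap.mul k C)) ∘ₗ
      (map (lift r.flip) (lift l.flip)) ∘ₗ
      (tensorTensorTensorComm k C C B B).toLinearMap ∘ₗ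
      (map LinearMap.id (TensorProduct.comm k B B).toLinearMap))
    LinearMap.id) ∘ₗ
  (TensorProduct.assoc k (C ⊗[k] C) (B ⊗[k] B) B).symm.toLinearMap ∘ₗ
    (map LinearMap.id ((map LinearMap.id (LinearMap.mul' k B)) ∘ₗ
      (tensorTensorTensorComm k B B B B).toLinearMap))

theorem lrs_core_tmul  (f g : C) (a a' b b' : B) :
    lrsCore l r ((f ⊗ₜ g) ⊗ₜ ((a ⊗ₜ a') ⊗ₜ (b ⊗ₜ b'))) =
      (r b f * l a g) ⊗ₜ[k] (a' * b') := by
  simp [lrsCore]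

theorem lrs_mul_tmul  (f g : C) (a b : B) :
    lrMul k C B (LinearMap.mul k C) l r ((f ⊗ₜ a) ⊗ₜ (g ⊗ₜ b))
      = lrsCore l r ((f ⊗ₜ g) ⊗ₜ (comul a ⊗ₜ comul b)) := by
  simp [lrMul, lrsCore]

/-- antipode with arbitrary threefold tensor -/
noncomputable def lrsAnti  (f : C) : B ⊗[k] (B ⊗[k] B) →ₗ[k] C ⊗[k] B :=
  (map (lift (l.compl₂ (r.flip (antipode k f) ∘ₗ antipode k)
      ∘ₗ antipode k)) (antipode k)) ∘ₗ (TensorProduct.assoc k B B B).symm.toLinearMap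

theorem lrs_anti_tmul  (f : C) (x y z : B) :
    lrsAnti l r f (x ⊗ₜ (y ⊗ₜ z)) =
      l (antipode k x) (r (antipode k y) (antipode k f)) ⊗ₜ
        antipode k z := by
  simp [lrsAnti]

theorem lrs_antipode_tmul  (f : C) (a : B) :
    lrAntipode k C B l r (f ⊗ₜ a) =
      lrsAnti l r f (map LinearMap.id (comul (R := k))
        (comul (R := k) a)) := by
  simp only [lrAntipode, LinearMap.comp_apply, map_tmul, LinearMap.id_apply]
  generalize map LinearMap.id (comul (R := k))
        (comul (R := k) a) = w
  induction w using TensorProduct.induction_on with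
  | zero => simp
  | add x y hx hy => simp only [tmul_add, map_add, hx, hy]
  | tmul x w =>
    induction w using TensorProduct.induction_on with
    | zero => simp
    | add y z hy hz => simp only [tmul_add, map_add, hy, hz]
    | tmul y z => simp [lrs_anti_tmul]

/-- contraction for the right antipode identity -/
noncomputable def lrsNR  (f g : C) : (B ⊗[k] B) ⊗[k] (B ⊗[k] B) →ₗ[k] C ⊗[k] B :=
  map (LinearMap.mul' k C ∘ₗ (TensorProduct.comm k C C).toLinearMap) LinearMap.id ∘ₗ
  (TensorProduct.assoc k C C B).symm.toLinearMap ∘ₗ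
  map
    (lift l ∘ₗ map LinearMap.id (r.flip g ∘ₗ antipode k))
    (map (r.flip f ∘ₗ antipode k) LinearMap.id ∘ₗ
      (TensorProduct.comm k B B).toLinearMap) ∘ₗ
  (tensorTensorTensorComm k B B B B).toLinearMap

theorem lrs_NR_tmul  (f g : C) (b b' q q' : B) :
    lrsNR l r f g ((b ⊗ₜ b') ⊗ₜ (q ⊗ₜ q')) =
      (r (antipode k q') f * l b (r (antipode k q) g)) ⊗ₜ b' := by
  simp [lrsNR]

/-- contraction for the left antipode identity -/
noncomputable def lrsNL  (f g : C) : (B ⊗[k] B) ⊗[k] (B ⊗[k] B) →ₗ[k] C ⊗[k] B :=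
  map (LinearMap.mul' k C) LinearMap.id ∘ₗ
  (TensorProduct.assoc k C C B).symm.toLinearMap ∘ₗ
  map
    (lift l ∘ₗ map (antipode k) (r.flip f))
    (map (l.flip g ∘ₗ antipode k) LinearMap.id) ∘ₗ
  (tensorTensorTensorComm k B B B B).toLinearMap

theorem lrs_NL_tmul  (f g : C) (b b' q q' : B) :
    lrsNL l r f g ((q ⊗ₜ q') ⊗ₜ (b ⊗ₜ b')) =
      (l (antipode k q) (r b f) * l (antipode k q') g) ⊗ₜ b' := by
  simp [lrsNL]

/-- The value of `(id ⋆ J)` on a pair of elements of `C` and an element of `B ⊗ B`. -/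
theorem lrs_stepR [IsCocomm k B] 
    (hlmod : ∀ (a b : B) (f : C), l (a * b) f = l a (l b f)) (f g : C) (x y : B) :
    lrMul k C B (LinearMap.mul k C) l r ((f ⊗ₜ x) ⊗ₜ lrAntipode k C B l r (g ⊗ₜ y)) =
    lrsNR l r f (antipode k g)
     (map (map
        (LinearMap.mul' k B ∘ₗ map LinearMap.id (antipode k))
        (LinearMap.mul' k B ∘ₗ map LinearMap.id (antipode k)) ∘ₗ
        (tensorTensorTensorComm k B B B B).toLinearMap) LinearMap.id
     ((TensorProduct.assoc k (B ⊗[k] B) (B ⊗[k] B) (B ⊗[k] B)).symm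
      ((comul (R := k) x) ⊗ₜ (
      (tensorTensorTensorComm k B B B B).toLinearMap ((TensorProduct.assoc k B B (B ⊗[k] B)).symm
      (map LinearMap.id
        (map LinearMap.id (comul (R := k) (A := B)))
      (map LinearMap.id (comul (R := k) (A := B))
      (comul (R := k) y)))))))) := by
  rw [lrs_antipode_tmul]
  generalize map LinearMap.id (comul (R := k))
        (comul (R := k) y) = w
  induction w using TensorProduct.induction_on with
  | zero => simp
  | add x y hx hy => simp only [tmul_add, map_add, hx, hy]
  | tmul y1 w =>
    induction w using TensorProduct.induction_on with
    | zero => simp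
    | add y z hy hz => simp only [tmul_add, map_add, hy, hz]
    | tmul y2 y3 =>
      rw [lrs_anti_tmul, lrs_mul_tmul, lrs_comul_antipode']
      simp only [map_tmul, LinearMap.id_apply]
      generalize comul (R := k) x = u
      generalize comul (R := k) y3 = v
      induction u using TensorProduct.induction_on with
      | zero => simp
      | add x y hx hy => simp only [tmul_add, add_tmul, map_add, hx, hy]
      | tmul x1 x2 =>
        induction v using TensorProduct.induction_on with
        | zero => simp
        | add x y hx hy => simp only [tmul_add, add_tmul, map_add, hx, hy]
        | tmul y31 y32 => simp [lrs_core_tmul, lrs_NR_tmul, hlmod]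

/-- The value of `(J ⋆ id)` on a pair of elements of `C` and an element of `B ⊗ B`. -/
theorem lrs_stepL [IsCocomm k B] 
    (hrmod : ∀ (a b : B) (f : C), r (a * b) f = r b (r a f))
    (hcompat : ∀ (a b : B) (f : C), r b (l a f) = l a (r b f)) (f g : C) (x y : B) :
    lrMul k C B (LinearMap.mul k C) l r (lrAntipode k C B l r (f ⊗ₜ y) ⊗ₜ (g ⊗ₜ x)) =
    lrsNL l r (antipode k f) g
     (map LinearMap.id (map
        (LinearMap.mul' k B ∘ₗ map (antipode k) LinearMap.id)
        (LinearMap.mul' k B ∘ₗ map (antipode k) LinearMap.id) ∘ₗ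
        (tensorTensorTensorComm k B B B B).toLinearMap)
     ((TensorProduct.assoc k (B ⊗[k] B) (B ⊗[k] B) (B ⊗[k] B))
      ((
      (tensorTensorTensorComm k B B B B).toLinearMap ((TensorProduct.assoc k B B (B ⊗[k] B)).symm
      (map LinearMap.id
        (map LinearMap.id (comul (R := k) (A := B)))
      (map LinearMap.id (comul (R := k) (A := B))
      (comul (R := k) y)))))  ⊗ₜ (comul (R := k) x)))) := by
  rw [lrs_antipode_tmul]
  generalize map LinearMap.id (comul (R := k))
        (comul (R := k) y) = w
  induction w using TensorProduct.induction_on with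
  | zero => simp
  | add x y hx hy => simp only [add_tmul, map_add, hx, hy]
  | tmul y1 w =>
    induction w using TensorProduct.induction_on with
    | zero => simp
    | add y z hy hz =>
      simp only [tmul_add, add_tmul, map_add, hy, hz]
    | tmul y2 y3 =>
      rw [lrs_anti_tmul, lrs_mul_tmul, lrs_comul_antipode]
      simp only [map_tmul, LinearMap.id_apply]
      generalize comul (R := k) x = u
      generalize comul (R := k) y3 = v
      induction u using TensorProduct.induction_on with
      | zero => simp
      | add x y hx hy => simp only [tmul_add, add_tmul, map_add, hx, hy]
      | tmul x1 x2 =>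
        induction v using TensorProduct.induction_on with
        | zero => simp
        | add x y hx hy =>
          simp only [tmul_add, add_tmul, map_add, hx, hy]
        | tmul y31 y32 => simp [lrs_core_tmul, lrs_NL_tmul, hrmod, hcompat]

theorem lrs_right [IsCocomm k B] 
    (hlmod : ∀ (a b : B) (f : C), l (a * b) f = l a (l b f))
    (hlone : ∀ f : C, l 1 f = f)
    (hralg : ∀ (a : B) (f g : C),
      r a (f * g) = sweedMul (LinearMap.mul k C) (r.flip f) (r.flip g) (comul a))
    (f g : C) (a : B) :
    lrMul k C B (LinearMap.mul k C) l r (map LinearMap.id (lrAntipode k C B l r)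
      (tensorTensorTensorComm k C C B B ((f ⊗ₜ g) ⊗ₜ comul (R := k) a)))
    = r (antipode k a) (f * antipode k g) ⊗ₜ 1 := by
  have key : ∀ u : B ⊗[k] B, lrMul k C B (LinearMap.mul k C) l r
      (map LinearMap.id (lrAntipode k C B l r)
      (tensorTensorTensorComm k C C B B ((f ⊗ₜ g) ⊗ₜ u))) =
      lrsNR l r f (antipode k g)
     (map (map
        (LinearMap.mul' k B ∘ₗ map LinearMap.id (antipode k))
        (LinearMap.mul' k B ∘ₗ map LinearMap.id (antipode k)) ∘ₗ
        (tensorTensorTensorComm k B B B B).toLinearMap) LinearMap.id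
     ((TensorProduct.assoc k (B ⊗[k] B) (B ⊗[k] B) (B ⊗[k] B)).symm
      (map (comul (R := k))
        ((map (comul (R := k) (A := B)) (comul (R := k) (A := B))) ∘ₗ
          comul (R := k)) u))) := by
    intro u
    rw [← lrs_tree4b]
    induction u using TensorProduct.induction_on with
    | zero => simp
    | add x y hx hy => simp only [tmul_add, map_add, hx, hy]
    | tmul x y =>
      rw [tensorTensorTensorComm_tmul, map_tmul, LinearMap.id_apply,
        lrs_stepR l r hlmod]
      rfl
  rw [key]
  have h6 := LinearMap.congr_fun (lrs_tree6 (k := k) (B := B)) a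
  simp only [LinearMap.comp_apply, LinearEquiv.coe_coe] at h6
  rw [h6, ← LinearMap.comp_apply (map _ LinearMap.id), ← map_comp,
    LinearMap.id_comp, LinearMap.comp_assoc, lrs_tree4, lrs_contractR]
  have h7 : map
      (LinearMap.toSpanSingleton k _ ((1 : B) ⊗ₜ[k] (1 : B)) ∘ₗ counit (R := k))
      (comul (R := k) (A := B)) (comul (R := k) a) = ((1 : B) ⊗ₜ[k] (1 : B)) ⊗ₜ comul (R := k) a := by
    have e : map
      (LinearMap.toSpanSingleton k _ ((1 : B) ⊗ₜ[k] (1 : B)) ∘ₗ counit (R := k))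
      (comul (R := k) (A := B)) (comul (R := k) a) =
      map (LinearMap.toSpanSingleton k _ ((1 : B) ⊗ₜ[k] (1 : B)))
        (comul (R := k) (A := B)) (LinearMap.rTensor B (counit (R := k)) (comul (R := k) a)) := by
      exact (LinearMap.congr_fun (LinearMap.map_comp_rTensor _ _ _ _) (comul (R := k) a)).symm
    rw [e, rTensor_counit_comul]
    simp
  rw [h7, hralg, lrs_comul_antipode']
  generalize comul (R := k) a = u
  induction u using TensorProduct.induction_on with
  | zero => simp
  | add x y hx hy => simp only [tmul_add, add_tmul, map_add, hx, hy]
  | tmul x y => simp [lrs_NR_tmul, sweedMul, hlone]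

theorem lrs_left [IsCocomm k B] 
    (hrmod : ∀ (a b : B) (f : C), r (a * b) f = r b (r a f))
    (hcompat : ∀ (a b : B) (f : C), r b (l a f) = l a (r b f))
    (hrone : ∀ f : C, r 1 f = f)
    (hlalg : ∀ (a : B) (f g : C),
      l a (f * g) = sweedMul (LinearMap.mul k C) (l.flip f) (l.flip g) (comul a))
    (f g : C) (a : B) :
    lrMul k C B (LinearMap.mul k C) l r (map (lrAntipode k C B l r) LinearMap.id
      (tensorTensorTensorComm k C C B B ((f ⊗ₜ g) ⊗ₜ comul (R := k) a)))
    = l (antipode k a) (antipode k f * g) ⊗ₜ 1 := by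
  have key : ∀ u : B ⊗[k] B, lrMul k C B (LinearMap.mul k C) l r
      (map (lrAntipode k C B l r) LinearMap.id
      (tensorTensorTensorComm k C C B B ((f ⊗ₜ g) ⊗ₜ u))) =
      lrsNL l r (antipode k f) g
     (map LinearMap.id (map
        (LinearMap.mul' k B ∘ₗ map (antipode k) LinearMap.id)
        (LinearMap.mul' k B ∘ₗ map (antipode k) LinearMap.id) ∘ₗ
        (tensorTensorTensorComm k B B B B).toLinearMap)
     ((TensorProduct.assoc k (B ⊗[k] B) (B ⊗[k] B) (B ⊗[k] B))
      (map
        ((map (comul (R := k) (A := B)) (comul (R := k) (A := B))) ∘ₗ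
          comul (R := k)) (comul (R := k)) u))) := by
    intro u
    rw [← lrs_tree4b]
    induction u using TensorProduct.induction_on with
    | zero => simp
    | add x y hx hy => simp only [tmul_add, map_add, hx, hy]
    | tmul x y =>
      rw [tensorTensorTensorComm_tmul, map_tmul, LinearMap.id_apply,
        lrs_stepL l r hrmod hcompat]
      rfl
  rw [key]
  have h6 := LinearMap.congr_fun (lrs_tree6' (k := k) (B := B)) a
  simp only [LinearMap.comp_apply, LinearEquiv.coe_coe] at h6
  rw [h6, ← LinearMap.comp_apply (map LinearMap.id _), ← map_comp,
    LinearMap.id_comp, LinearMap.comp_assoc, lrs_tree4, lrs_contractL]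
  have h7 : map (comul (R := k) (A := B))
      (LinearMap.toSpanSingleton k _ ((1 : B) ⊗ₜ[k] (1 : B)) ∘ₗ counit (R := k))
      (comul (R := k) a) = comul (R := k) a ⊗ₜ ((1 : B) ⊗ₜ[k] (1 : B)) := by
    have e : map (comul (R := k) (A := B))
      (LinearMap.toSpanSingleton k _ ((1 : B) ⊗ₜ[k] (1 : B)) ∘ₗ counit (R := k))
      (comul (R := k) a) =
      map (comul (R := k) (A := B))
        (LinearMap.toSpanSingleton k _ ((1 : B) ⊗ₜ[k] (1 : B)))
        (LinearMap.lTensor B (counit (R := k)) (comul (R := k) a)) := by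
      exact (LinearMap.congr_fun (LinearMap.map_comp_lTensor _ _ _ _) (comul (R := k) a)).symm
    rw [e, lTensor_counit_comul]
    simp
  rw [h7, hlalg, lrs_comul_antipode]
  generalize comul (R := k) a = u
  induction u using TensorProduct.induction_on with
  | zero => simp
  | add x y hx hy => simp only [add_tmul, map_add, hx, hy]
  | tmul x y => simp [lrs_NL_tmul, sweedMul, hrone]

/-- the common value of both sides of multiplicativity of the coproduct -/
noncomputable def lrsT 
    (X Y : C ⊗[k] C) (P Q : (B ⊗[k] B) ⊗[k] (B ⊗[k] B)) : (C ⊗[k] B) ⊗[k] (C ⊗[k] B) :=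
  map (lrsCore l r) (lrsCore l r)
    (tensorTensorTensorComm k _ _ _ _ ((tensorTensorTensorComm k C C C C (X ⊗ₜ Y)) ⊗ₜ
     (tensorTensorTensorComm k _ _ _ _ (P ⊗ₜ Q))))

theorem lrs_comul_rhs  (X Y : C ⊗[k] C) (u v : B ⊗[k] B) :
    (map (lrMul k C B (LinearMap.mul k C) l r)
            (lrMul k C B (LinearMap.mul k C) l r))
          ((tensorTensorTensorComm k (C ⊗[k] B) (C ⊗[k] B) (C ⊗[k] B) (C ⊗[k] B))
            ((tensorTensorTensorComm k C C B B (X ⊗ₜ u)) ⊗ₜ[k]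
             (tensorTensorTensorComm k C C B B (Y ⊗ₜ v)))) =
    lrsT l r X Y (map (comul (R := k)) (comul (R := k)) u)
      (map (comul (R := k)) (comul (R := k)) v) := by
  unfold lrsT
  induction X using TensorProduct.induction_on with
  | zero => simp
  | add x y hx hy => simp only [add_tmul, map_add, hx, hy]
  | tmul f1 f2 =>
  induction Y using TensorProduct.induction_on with
  | zero => simp
  | add x y hx hy => simp only [add_tmul, tmul_add, map_add, hx, hy]
  | tmul g1 g2 =>
  induction u using TensorProduct.induction_on with
  | zero => simp
  | add x y hx hy => simp only [add_tmul, tmul_add, map_add, hx, hy]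
  | tmul a1 a2 =>
  induction v using TensorProduct.induction_on with
  | zero => simp
  | add x y hx hy => simp only [tmul_add, map_add, hx, hy]
  | tmul b1 b2 =>
  simp only [tensorTensorTensorComm_tmul, map_tmul, lrs_mul_tmul]

set_option maxHeartbeats 4000000 in
theorem lrs_comul_lhs 
    (hlco : ∀ (a : B) (f : C),
      comul (R := k) (l a f) =
        ((map (lift l) (lift l)) ∘ₗ
          (tensorTensorTensorComm k B B C C).toLinearMap)
        ((comul (R := k) a) ⊗ₜ[k] (comul (R := k) f)))
    (hrco : ∀ (a : B) (f : C),
      comul (R := k) (r a f) =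
        ((map (lift r) (lift r)) ∘ₗ
          (tensorTensorTensorComm k B B C C).toLinearMap)
        ((comul (R := k) a) ⊗ₜ[k] (comul (R := k) f)))
    (f g : C) (u v : B ⊗[k] B) :
    tensorComul k C B (lrsCore l r ((f ⊗ₜ g) ⊗ₜ (u ⊗ₜ v))) =
    lrsT l r (comul (R := k) f) (comul (R := k) g)
      (tensorTensorTensorComm k B B B B (map (comul (R := k)) (comul (R := k)) u))
      (tensorTensorTensorComm k B B B B (map (comul (R := k)) (comul (R := k)) v)) := by
  unfold lrsT
  induction u using TensorProduct.induction_on with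
  | zero => simp
  | add x y hx hy => simp only [add_tmul, tmul_add, map_add, hx, hy]
  | tmul a1 a2 =>
  induction v using TensorProduct.induction_on with
  | zero => simp
  | add x y hx hy => simp only [tmul_add, map_add, hx, hy]
  | tmul b1 b2 =>
  simp only [lrs_core_tmul, tensorComul, LinearMap.comp_apply, map_tmul,
    Bialgebra.comul_mul, hlco, hrco]
  generalize comul (R := k) f = X
  generalize comul (R := k) g = Y
  generalize comul (R := k) a1 = A1
  generalize comul (R := k) a2 = A2
  generalize comul (R := k) b1 = B1
  generalize comul (R := k) b2 = B2
  induction X using TensorProduct.induction_on with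
  | zero => simp
  | add x y hx hy =>
    simp only [add_tmul, tmul_add, map_add, add_mul, mul_add, hx, hy]
  | tmul f1 f2 =>
  induction Y using TensorProduct.induction_on with
  | zero => simp
  | add x y hx hy =>
    simp only [add_tmul, tmul_add, map_add, add_mul, mul_add, hx, hy]
  | tmul g1 g2 =>
  induction A1 using TensorProduct.induction_on with
  | zero => simp
  | add x y hx hy =>
    simp only [add_tmul, tmul_add, map_add, add_mul, mul_add, hx, hy]
  | tmul a1 a1' =>
  induction A2 using TensorProduct.induction_on with
  | zero => simp
  | add x y hx hy =>
    simp only [add_tmul, tmul_add, map_add, add_mul, mul_add, hx, hy]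
  | tmul a2 a2' =>
  induction B1 using TensorProduct.induction_on with
  | zero => simp
  | add x y hx hy =>
    simp only [add_tmul, tmul_add, map_add, add_mul, mul_add, hx, hy]
  | tmul b1 b1' =>
  induction B2 using TensorProduct.induction_on with
  | zero => simp
  | add x y hx hy =>
    simp only [add_tmul, tmul_add, map_add, add_mul, mul_add, hx, hy]
  | tmul b2 b2' =>
  simp [lrs_core_tmul]

end LRSmashHelpers

/-- if `B` is a cocommutative Hopf algebra and `C` a Hopf algebra which is
a `B`-bimodule bialgebra, then the L-R smash product `C ♮ B` with the tensor product
coalgebra structure is a Hopf algebra, with antipode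
`J⋆(f⊗a) = Σ J_B(a₁) ⇀ J_C(f) ↼ J_B(a₂) ⊗ J_B(a₃)`. -/
theorem lr_smash_hopf (k C B : Type*) [Field k]
    [Ring C] [HopfAlgebra k C] [Ring B] [HopfAlgebra k B]
    (l r : B →ₗ[k] C →ₗ[k] C)
    -- `B` is cocommutative
    (hcoc : ∀ b : B, (TensorProduct.comm k B B) (Coalgebra.comul b) = Coalgebra.comul b)
    -- module structures
    (hlmod : ∀ (a b : B) (f : C), l (a * b) f = l a (l b f))
    (hrmod : ∀ (a b : B) (f : C), r (a * b) f = r b (r a f))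
    (hlone : ∀ f : C, l 1 f = f) (hrone : ∀ f : C, r 1 f = f)
    -- module algebra structures
    (hlalg : ∀ (a : B) (f g : C),
      l a (f * g) = sweedMul (LinearMap.mul k C) (l.flip f) (l.flip g) (Coalgebra.comul a))
    (hralg : ∀ (a : B) (f g : C),
      r a (f * g) = sweedMul (LinearMap.mul k C) (r.flip f) (r.flip g) (Coalgebra.comul a))
    (hlunit : ∀ a : B, l a 1 = (Coalgebra.counit (R := k) a) • (1 : C))
    (hrunit : ∀ a : B, r a 1 = (Coalgebra.counit (R := k) a) • (1 : C))
    -- compatibility of the two actions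
    (hcompat : ∀ (a b : B) (f : C), r b (l a f) = l a (r b f))
    -- the actions are coalgebra morphisms: `Δ_C(a ⇀ f) = Δ_B(a) ⇀ Δ_C(f)` etc.
    (hlco : ∀ (a : B) (f : C),
      Coalgebra.comul (R := k) (l a f) =
        ((TensorProduct.map (TensorProduct.lift l) (TensorProduct.lift l)) ∘ₗ
          (tensorTensorTensorComm k B B C C).toLinearMap)
        ((Coalgebra.comul (R := k) a) ⊗ₜ[k] (Coalgebra.comul (R := k) f)))
    (hrco : ∀ (a : B) (f : C),
      Coalgebra.comul (R := k) (r a f) =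
        ((TensorProduct.map (TensorProduct.lift r) (TensorProduct.lift r)) ∘ₗ
          (tensorTensorTensorComm k B B C C).toLinearMap)
        ((Coalgebra.comul (R := k) a) ⊗ₜ[k] (Coalgebra.comul (R := k) f)))
    (hlcounit : ∀ (a : B) (f : C),
      Coalgebra.counit (R := k) (l a f) =
        Coalgebra.counit (R := k) a * Coalgebra.counit (R := k) f)
    (hrcounit : ∀ (a : B) (f : C),
      Coalgebra.counit (R := k) (r a f) =
        Coalgebra.counit (R := k) a * Coalgebra.counit (R := k) f) :
    -- the coproduct is multiplicative w.r.t. the smash product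
    (∀ x y : C ⊗[k] B,
      tensorComul k C B (lrMul k C B (LinearMap.mul k C) l r (x ⊗ₜ[k] y)) =
        (TensorProduct.map (lrMul k C B (LinearMap.mul k C) l r)
            (lrMul k C B (LinearMap.mul k C) l r))
          ((tensorTensorTensorComm k (C ⊗[k] B) (C ⊗[k] B) (C ⊗[k] B) (C ⊗[k] B))
            ((tensorComul k C B x) ⊗ₜ[k] (tensorComul k C B y)))) ∧
    -- the counit is multiplicative
    (∀ x y : C ⊗[k] B,
      tensorCounit k C B (lrMul k C B (LinearMap.mul k C) l r (x ⊗ₜ[k] y)) =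
        tensorCounit k C B x * tensorCounit k C B y) ∧
    -- unit compatibility
    (tensorComul k C B ((1 : C) ⊗ₜ[k] (1 : B)) =
      ((1 : C) ⊗ₜ[k] (1 : B)) ⊗ₜ[k] ((1 : C) ⊗ₜ[k] (1 : B))) ∧
    (tensorCounit k C B ((1 : C) ⊗ₜ[k] (1 : B)) = 1) ∧
    -- the antipode identities
    (∀ x : C ⊗[k] B,
      lrMul k C B (LinearMap.mul k C) l r
          ((TensorProduct.map (lrAntipode k C B l r) LinearMap.id) (tensorComul k C B x)) =
        (tensorCounit k C B x) • ((1 : C) ⊗ₜ[k] (1 : B))) ∧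
    (∀ x : C ⊗[k] B,
      lrMul k C B (LinearMap.mul k C) l r
          ((TensorProduct.map LinearMap.id (lrAntipode k C B l r)) (tensorComul k C B x)) =
        (tensorCounit k C B x) • ((1 : C) ⊗ₜ[k] (1 : B))) := by
  have : Coalgebra.IsCocomm k B := ⟨LinearMap.ext hcoc⟩
  refine ⟨?_, ?_, ?_, ?_, ?_, ?_⟩
  · intro x y
    induction x using TensorProduct.induction_on with
    | zero => simp
    | add x y hx hy => simp only [TensorProduct.add_tmul, map_add, hx, hy]
    | tmul f a =>
    induction y using TensorProduct.induction_on with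
    | zero => simp
    | add x y hx hy => simp only [TensorProduct.tmul_add, map_add, hx, hy]
    | tmul g b =>
    rw [lrs_mul_tmul, lrs_comul_lhs l r hlco hrco]
    have h := fun c => LinearMap.congr_fun (lrs_tree4 (k := k) (B := B)) c
    simp only [LinearMap.comp_apply, LinearEquiv.coe_coe] at h
    rw [h, h]
    exact (lrs_comul_rhs l r _ _ _ _).symm
  · intro x y
    induction x using TensorProduct.induction_on with
    | zero => simp
    | add x y hx hy => simp only [TensorProduct.add_tmul, map_add, add_mul, hx, hy]
    | tmul f a =>
    induction y using TensorProduct.induction_on with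
    | zero => simp
    | add x y hx hy => simp only [TensorProduct.tmul_add, map_add, mul_add, hx, hy]
    | tmul g b =>
    rw [lrs_mul_tmul]
    have key : ∀ u v : B ⊗[k] B,
        tensorCounit k C B (lrsCore l r ((f ⊗ₜ g) ⊗ₜ (u ⊗ₜ v))) =
        Coalgebra.counit (R := k) f * Coalgebra.counit (R := k) g *
        (TensorProduct.lid k k (TensorProduct.map Coalgebra.counit Coalgebra.counit u)) *
        (TensorProduct.lid k k (TensorProduct.map Coalgebra.counit Coalgebra.counit v)) := by
      intro u v
      induction u using TensorProduct.induction_on with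
      | zero => simp
      | add x y hx hy =>
        simp only [TensorProduct.add_tmul, TensorProduct.tmul_add, map_add, mul_add, add_mul, hx, hy]
      | tmul a1 a2 =>
      induction v using TensorProduct.induction_on with
      | zero => simp
      | add x y hx hy => simp only [TensorProduct.tmul_add, map_add, mul_add, hx, hy]
      | tmul b1 b2 =>
      simp [lrs_core_tmul, tensorCounit, hlcounit, hrcounit]
      ring
    rw [key, lrs_counit_counit, lrs_counit_counit]
    simp [tensorCounit]
    ring
  · simp [tensorComul, Algebra.TensorProduct.one_def]
  · simp [tensorCounit]
  · intro x
    induction x using TensorProduct.induction_on with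
    | zero => simp
    | add x y hx hy => simp only [map_add, add_smul, hx, hy]
    | tmul f a =>
    have key : ∀ X : C ⊗[k] C, lrMul k C B (LinearMap.mul k C) l r
        (TensorProduct.map (lrAntipode k C B l r) LinearMap.id
        (tensorTensorTensorComm k C C B B (X ⊗ₜ Coalgebra.comul (R := k) a))) =
        l (HopfAlgebra.antipode k a)
          (LinearMap.mul' k C (LinearMap.rTensor C (HopfAlgebra.antipode k) X)) ⊗ₜ 1 := by
      intro X
      induction X using TensorProduct.induction_on with
      | zero => simp
      | add x y hx hy => simp only [TensorProduct.add_tmul, map_add, hx, hy]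
      | tmul f g =>
      rw [lrs_left l r hrmod hcompat hrone hlalg]
      simp
    refine (key (Coalgebra.comul f)).trans ?_
    rw [HopfAlgebra.mul_antipode_rTensor_comul_apply]
    simp [tensorCounit, Algebra.algebraMap_eq_smul_one, hlunit, TensorProduct.smul_tmul', smul_smul]
  · intro x
    induction x using TensorProduct.induction_on with
    | zero => simp
    | add x y hx hy => simp only [map_add, add_smul, hx, hy]
    | tmul f a =>
    have key : ∀ X : C ⊗[k] C, lrMul k C B (LinearMap.mul k C) l r
        (TensorProduct.map LinearMap.id (lrAntipode k C B l r)
        (tensorTensorTensorComm k C C B B (X ⊗ₜ Coalgebra.comul (R := k) a))) =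
        r (HopfAlgebra.antipode k a)
          (LinearMap.mul' k C (LinearMap.lTensor C (HopfAlgebra.antipode k) X)) ⊗ₜ 1 := by
      intro X
      induction X using TensorProduct.induction_on with
      | zero => simp
      | add x y hx hy => simp only [TensorProduct.add_tmul, map_add, hx, hy]
      | tmul f g =>
      rw [lrs_right l r hlmod hlone hralg]
      simp
    refine (key (Coalgebra.comul f)).trans ?_
    rw [HopfAlgebra.mul_antipode_lTensor_comul_apply]
    simp [tensorCounit, Algebra.algebraMap_eq_smul_one, hrunit, TensorProduct.smul_tmul', smul_smul]
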